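/- Let 0<β<1, let φ be integrable on (0,∞) and let ξ be measurable on (0,∞) with ∫₀^∞ |ξ(v)| K₀(βv) dv < ∞. Define ψ(x) = (φ ∗_{F_s,F_c} √(π/2)·e^{−·})(x) and f = ψ ⋆ ξ. Then for every y>0, (1+y²)·(F_c f)(y) = sin(y)·(F_s φ)(y)·K[ξ](y). -/

import Mathlib

open MeasureTheory Real Set

/-- The kernel function φ(x,u,v). -/
noncomputable def phiKer (x u v : ℝ) : ℝ :=
  Real.exp (-v * Real.cosh (x + u - 1)) + Real.exp (-v * Real.cosh (x - u + 1))
    - Real.exp (-v * Real.cosh (x + u + 1)) - Real.exp (-v * Real.cosh (x - u - 1))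

/-- The modified Bessel function of the second kind of order zero. -/
noncomputable def K0 (v : ℝ) : ℝ := ∫ t in Set.Ioi (0 : ℝ), Real.exp (-v * Real.cosh t)

/-- The trigonometric-weighted generalized convolution (f ⋆ g). -/
noncomputable def gconv (f g : ℝ → ℝ) (x : ℝ) : ℝ :=
  (1 / 4) * ∫ v in Set.Ioi (0 : ℝ), ∫ u in Set.Ioi (0 : ℝ), phiKer x u v * f u * g v

/-- Fourier cosine transform. -/
noncomputable def Fc (f : ℝ → ℝ) (y : ℝ) : ℝ :=
  Real.sqrt (2 / Real.pi) * ∫ x in Set.Ioi (0 : ℝ), f x * Real.cos (x * y)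

/-- Fourier sine transform. -/
noncomputable def Fs (f : ℝ → ℝ) (y : ℝ) : ℝ :=
  Real.sqrt (2 / Real.pi) * ∫ x in Set.Ioi (0 : ℝ), f x * Real.sin (x * y)

/-- Modified Bessel function K_{iy}(x). -/
noncomputable def Kiy (y x : ℝ) : ℝ :=
  ∫ u in Set.Ioi (0 : ℝ), Real.exp (-x * Real.cosh u) * Real.cos (y * u)

/-- Kontorovich–Lebedev transform. -/
noncomputable def KL (g : ℝ → ℝ) (y : ℝ) : ℝ := ∫ x in Set.Ioi (0 : ℝ), Kiy y x * g x

/-- Fourier cosine convolution. -/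
noncomputable def fcConv (f g : ℝ → ℝ) (x : ℝ) : ℝ :=
  (1 / Real.sqrt (2 * Real.pi)) * ∫ u in Set.Ioi (0 : ℝ), f u * (g |x - u| + g (x + u))

/-- Fourier sine–cosine generalized convolution. -/
noncomputable def fscConv (f g : ℝ → ℝ) (x : ℝ) : ℝ :=
  (1 / Real.sqrt (2 * Real.pi)) * ∫ u in Set.Ioi (0 : ℝ), f u * (g |x - u| - g (x + u))

/-- Splitting an integral over the line into its two halves. -/
theorem integral_eq_integral_Ioi_add_neg {F : ℝ → ℝ} (hF : Integrable F) :
    ∫ x, F x = ∫ x in Ioi (0 : ℝ), (F x + F (-x)) := by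
  have hneg : Integrable fun x => F (-x) := hF.comp_neg
  rw [integral_add hF.integrableOn hneg.integrableOn, integral_comp_neg_Ioi, neg_zero, add_comm,
    ← setIntegral_union (Iic_disjoint_Ioi le_rfl) measurableSet_Ioi hF.integrableOn
      hF.integrableOn, Iic_union_Ioi, Measure.restrict_univ]

theorem integrable_mul_cos {α : Type*} [MeasurableSpace α] {μ : Measure α} {k : α → ℝ}
    (hk : Integrable k μ) {p : α → ℝ} (hp : Measurable p) :
    Integrable (fun x => k x * Real.cos (p x)) μ :=
  hk.mul_bdd (c := 1) (by fun_prop) (.of_forall fun x => by simpa using Real.abs_cos_le_one _)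

theorem integrable_mul_sin {α : Type*} [MeasurableSpace α] {μ : Measure α} {k : α → ℝ}
    (hk : Integrable k μ) {p : α → ℝ} (hp : Measurable p) :
    Integrable (fun x => k x * Real.sin (p x)) μ :=
  hk.mul_bdd (c := 1) (by fun_prop) (.of_forall fun x => by simpa using Real.abs_sin_le_one _)

theorem integral_even_mul_sin {k : ℝ → ℝ} (heven : ∀ x, k (-x) = k x) (y : ℝ) :
    ∫ x, k x * Real.sin (x * y) = 0 := by
  have h := integral_neg_eq_self (fun x => k x * Real.sin (x * y)) volume
  simp only [heven, neg_mul, Real.sin_neg, mul_neg, integral_neg] at h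
  linarith

theorem integral_even_mul_cos {k : ℝ → ℝ} (heven : ∀ x, k (-x) = k x) (y : ℝ) :
    ∫ x, k x * Real.cos (x * y) = 2 * ∫ x in Ioi (0 : ℝ), k x * Real.cos (x * y) := by
  rw [← integral_comp_abs (f := fun x => k x * Real.cos (x * y))]
  congr 1 with x
  rcases abs_choice x with h | h <;> simp [h, heven]

theorem integral_Ioi_translates_mul_cos {k : ℝ → ℝ} (hk : Integrable k)
    (heven : ∀ x, k (-x) = k x) (a y : ℝ) :
    ∫ x in Ioi (0 : ℝ), (k (x + a) + k (x - a)) * Real.cos (x * y) =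
      2 * Real.cos (a * y) * ∫ x in Ioi (0 : ℝ), k x * Real.cos (x * y) := by
  have hF : Integrable fun x => k (x - a) * Real.cos (x * y) :=
    integrable_mul_cos (hk.comp_sub_right a) (by fun_prop)
  calc _ = ∫ x in Ioi (0 : ℝ),
        (k (x - a) * Real.cos (x * y) + k (-x - a) * Real.cos (-x * y)) := by
        congr 1 with x
        rw [show -x - a = -(x + a) by ring, heven, neg_mul, Real.cos_neg]
        ring
    _ = ∫ x, k (x - a) * Real.cos (x * y) := (integral_eq_integral_Ioi_add_neg hF).symm
    _ = ∫ x, k x * Real.cos ((x + a) * y) := by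
        rw [← integral_sub_right_eq_self (fun x => k x * Real.cos ((x + a) * y)) a]
        simp
    _ = ∫ x, (Real.cos (a * y) * (k x * Real.cos (x * y))
          - Real.sin (a * y) * (k x * Real.sin (x * y))) := by
        congr 1 with x
        rw [add_mul, Real.cos_add]
        ring
    _ = _ := by
        rw [integral_sub ((integrable_mul_cos hk (by fun_prop)).const_mul _)
          ((integrable_mul_sin hk (by fun_prop)).const_mul _), integral_const_mul,
          integral_const_mul, integral_even_mul_sin heven, integral_even_mul_cos heven]
        ring

theorem integral_Ioi_translates_mul_sin {k : ℝ → ℝ} (hk : Integrable k)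
    (heven : ∀ x, k (-x) = k x) (a y : ℝ) :
    ∫ x in Ioi (0 : ℝ), (k (x - a) - k (x + a)) * Real.sin (x * y) =
      2 * Real.sin (a * y) * ∫ x in Ioi (0 : ℝ), k x * Real.cos (x * y) := by
  have hF : Integrable fun x => k (x - a) * Real.sin (x * y) :=
    integrable_mul_sin (hk.comp_sub_right a) (by fun_prop)
  calc _ = ∫ x in Ioi (0 : ℝ),
        (k (x - a) * Real.sin (x * y) + k (-x - a) * Real.sin (-x * y)) := by
        congr 1 with x
        rw [show -x - a = -(x + a) by ring, heven, neg_mul, Real.sin_neg]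
        ring
    _ = ∫ x, k (x - a) * Real.sin (x * y) := (integral_eq_integral_Ioi_add_neg hF).symm
    _ = ∫ x, k x * Real.sin ((x + a) * y) := by
        rw [← integral_sub_right_eq_self (fun x => k x * Real.sin ((x + a) * y)) a]
        simp
    _ = ∫ x, (Real.sin (a * y) * (k x * Real.cos (x * y))
          + Real.cos (a * y) * (k x * Real.sin (x * y))) := by
        congr 1 with x
        rw [add_mul, Real.sin_add]
        ring
    _ = _ := by
        rw [integral_add ((integrable_mul_cos hk (by fun_prop)).const_mul _)
          ((integrable_mul_sin hk (by fun_prop)).const_mul _), integral_const_mul,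
          integral_const_mul, integral_even_mul_sin heven, integral_even_mul_cos heven]
        ring

theorem integrable_exp_neg_mul_abs {c : ℝ} (hc : 0 < c) :
    Integrable fun x : ℝ => Real.exp (-c * |x|) := by
  rw [← integrableOn_univ, ← Iic_union_Ioi (a := (0 : ℝ))]
  refine IntegrableOn.union ?_ ?_
  · refine (integrableOn_exp_mul_Iic hc 0).congr_fun (fun x hx => ?_) measurableSet_Iic
    simp [abs_of_nonpos (mem_Iic.mp hx)]
  · refine (integrableOn_exp_mul_Ioi (neg_lt_zero.mpr hc) 0).congr_fun (fun x hx => ?_)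
      measurableSet_Ioi
    simp [abs_of_pos (mem_Ioi.mp hx)]

theorem half_abs_le_cosh (x : ℝ) : |x| / 2 ≤ Real.cosh x := by
  rw [← Real.cosh_abs, Real.cosh_eq]
  have := Real.add_one_le_exp |x|
  have := Real.exp_pos (-|x|)
  linarith

theorem integrable_exp_neg_mul_cosh {v : ℝ} (hv : 0 < v) :
    Integrable fun x : ℝ => Real.exp (-v * Real.cosh x) := by
  refine (integrable_exp_neg_mul_abs (half_pos hv)).mono' (by fun_prop) (.of_forall fun x => ?_)
  rw [Real.norm_of_nonneg (Real.exp_pos _).le, Real.exp_le_exp]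
  nlinarith [half_abs_le_cosh x]

theorem integral_exp_neg_mul_cosh (v : ℝ) :
    ∫ x, Real.exp (-v * Real.cosh x) = 2 * K0 v := by
  simpa [K0] using integral_comp_abs (f := fun x => Real.exp (-v * Real.cosh x))

theorem K0_nonneg (v : ℝ) : 0 ≤ K0 v := integral_nonneg fun _ => (Real.exp_pos _).le

theorem K0_anti {v w : ℝ} (hv : 0 < v) (hvw : v ≤ w) : K0 w ≤ K0 v := by
  refine integral_mono (integrable_exp_neg_mul_cosh (hv.trans_le hvw)).integrableOn
    (integrable_exp_neg_mul_cosh hv).integrableOn fun t => ?_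
  have := Real.cosh_pos t
  simp only [Real.exp_le_exp]
  nlinarith

theorem measurable_K0 : Measurable K0 := by
  have : StronglyMeasurable (Function.uncurry fun v t : ℝ => Real.exp (-v * Real.cosh t)) :=
    Continuous.stronglyMeasurable (by fun_prop)
  exact (this.integral_prod_right (ν := volume.restrict (Ioi 0))).measurable

/-- A kernel translated by a parameter-dependent amount is jointly integrable as soon as the
weighted `L¹` norms of its slices are integrable in the parameter. -/
theorem integrable_translate_mul {α : Type*} [MeasurableSpace α] {ν : Measure α} [SFinite ν]
    {h : α → ℝ → ℝ} (hm : Measurable (Function.uncurry h)) {s w : α → ℝ} (hs : Measurable s)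
    (hw : AEStronglyMeasurable w ν) (hi : ∀ᵐ a ∂ν, Integrable (h a))
    (hn : Integrable (fun a => (∫ x, |h a x|) * |w a|) ν) :
    Integrable (fun p : ℝ × α => h p.2 (p.1 + s p.2) * w p.2)
      ((volume.restrict (Ioi (0 : ℝ))).prod ν) := by
  have key : Integrable (fun p : ℝ × α => h p.2 (p.1 + s p.2) * w p.2)
      ((volume : Measure ℝ).prod ν) := by
    have hm' : Measurable fun p : ℝ × α => h p.2 (p.1 + s p.2) :=
      hm.comp (g := Function.uncurry h) (f := fun p : ℝ × α => (p.2, p.1 + s p.2)) (by fun_prop)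
    have hprod : AEStronglyMeasurable (fun p : ℝ × α => h p.2 (p.1 + s p.2) * w p.2)
        ((volume : Measure ℝ).prod ν) :=
      hm'.aestronglyMeasurable.mul hw.comp_snd
    refine (integrable_prod_iff' hprod).mpr ⟨?_, ?_⟩
    · filter_upwards [hi] with a ha
      exact (ha.comp_add_right (s a)).mul_const _
    · refine hn.congr (.of_forall fun a => ?_)
      simp only [norm_mul, Real.norm_eq_abs, integral_mul_const]
      rw [integral_add_right_eq_self (fun x => |h a x|) (s a)]
  refine key.mono_measure ?_
  exact Measure.prod_mono Measure.restrict_le_self le_rfl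

theorem integral_exp_neg_mul_cos (y : ℝ) :
    ∫ x in Ioi (0 : ℝ), Real.exp (-|x|) * Real.cos (x * y) = 1 / (1 + y ^ 2) := by
  have ha : (-1 + y * Complex.I).re < 0 := by simp
  have h := integral_exp_mul_complex_Ioi ha 0
  have hre := congrArg Complex.re h
  rw [← RCLike.re_to_complex, ← integral_re (integrableOn_exp_mul_complex_Ioi ha 0)] at hre
  have e : ∫ x in Ioi (0 : ℝ), Real.exp (-|x|) * Real.cos (x * y) =
      ∫ x in Ioi (0 : ℝ), RCLike.re (Complex.exp ((-1 + y * Complex.I) * x)) := by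
    refine setIntegral_congr_fun measurableSet_Ioi fun x hx => ?_
    simp [Complex.exp_re, abs_of_pos (mem_Ioi.mp hx), mul_comm x y]
  rw [e, hre]
  simp [Complex.div_re, Complex.normSq_apply]
  ring

theorem integrableOn_mul_K0 {β : ℝ} (hβ : β ∈ Ioo (0 : ℝ) 1) {ξ : ℝ → ℝ} (hξm : Measurable ξ)
    (hξ : IntegrableOn (fun v => |ξ v| * K0 (β * v)) (Ioi 0)) :
    IntegrableOn (fun v => |ξ v| * K0 v) (Ioi 0) := by
  refine Integrable.mono' hξ (by have := measurable_K0; fun_prop) ?_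
  filter_upwards [ae_restrict_mem measurableSet_Ioi] with v hv
  have hv : 0 < v := hv
  rw [Real.norm_of_nonneg (mul_nonneg (abs_nonneg _) (K0_nonneg v))]
  exact mul_le_mul_of_nonneg_left (K0_anti (mul_pos hβ.1 hv) (by nlinarith [hβ.2]))
    (abs_nonneg _)

theorem fscConv_exp_eq (Φ : ℝ → ℝ) {x : ℝ} (hx : 0 < x) :
    fscConv Φ (fun t => Real.sqrt (Real.pi / 2) * Real.exp (-t)) x =
      ∫ u in Ioi (0 : ℝ), (1 / 2) * ((Real.exp (-|x - u|) - Real.exp (-|x + u|)) * Φ u) := by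
  rw [fscConv, ← integral_const_mul]
  refine setIntegral_congr_fun measurableSet_Ioi fun u hu => ?_
  have hs : Real.sqrt (2 * Real.pi) = 2 * Real.sqrt (Real.pi / 2) := by
    rw [show 2 * Real.pi = 2 ^ 2 * (Real.pi / 2) by ring, Real.sqrt_mul (by norm_num),
      Real.sqrt_sq (by norm_num)]
  have : Real.sqrt (Real.pi / 2) ≠ 0 := by positivity
  have hu : 0 < u := hu
  simp only [hs, abs_of_pos (add_pos hx hu)]
  field_simp

theorem integrable_exp_kernel {Φ : ℝ → ℝ} (hΦ : IntegrableOn Φ (Ioi 0)) :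
    Integrable (fun p : ℝ × ℝ =>
        (1 / 2) * ((Real.exp (-|p.1 - p.2|) - Real.exp (-|p.1 + p.2|)) * Φ p.2))
      ((volume.restrict (Ioi (0 : ℝ))).prod (volume.restrict (Ioi (0 : ℝ)))) := by
  have hk : Integrable fun x : ℝ => Real.exp (-|x|) := by
    simpa using integrable_exp_neg_mul_abs one_pos
  have aux (s : ℝ → ℝ) (hs : Measurable s) :=
    integrable_translate_mul (ν := volume.restrict (Ioi (0 : ℝ)))
      (h := fun _ x => Real.exp (-|x|)) (by fun_prop) hs hΦ.aestronglyMeasurable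
      (.of_forall fun _ => hk) (hΦ.abs.const_mul _)
  refine (((aux (fun u => -u) (by fun_prop)).sub (aux (fun u => u) (by fun_prop))).const_mul
    (1 / 2)).congr (.of_forall fun p => ?_)
  simp only [Pi.sub_apply, sub_eq_add_neg]
  ring

theorem integrableOn_fscConv_exp {Φ : ℝ → ℝ} (hΦ : IntegrableOn Φ (Ioi 0)) :
    IntegrableOn (fscConv Φ (fun t => Real.sqrt (Real.pi / 2) * Real.exp (-t))) (Ioi 0) :=
  IntegrableOn.congr_fun (integrable_exp_kernel hΦ).integral_prod_left
    (fun _ hx => (fscConv_exp_eq Φ hx).symm) measurableSet_Ioi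

theorem Fs_fscConv_exp {Φ : ℝ → ℝ} (hΦ : IntegrableOn Φ (Ioi 0)) (y : ℝ) :
    Fs (fscConv Φ (fun t => Real.sqrt (Real.pi / 2) * Real.exp (-t))) y =
      Fs Φ y / (1 + y ^ 2) := by
  have hk : Integrable fun x : ℝ => Real.exp (-|x|) := by
    simpa using integrable_exp_neg_mul_abs one_pos
  rw [Fs, Fs, mul_div_assoc]
  congr 1
  calc _ = ∫ x in Ioi (0 : ℝ), ∫ u in Ioi (0 : ℝ),
        (1 / 2) * ((Real.exp (-|x - u|) - Real.exp (-|x + u|)) * Φ u) * Real.sin (x * y) := by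
        refine setIntegral_congr_fun measurableSet_Ioi fun x hx => ?_
        rw [fscConv_exp_eq Φ hx, ← integral_mul_const]
    _ = ∫ u in Ioi (0 : ℝ), ∫ x in Ioi (0 : ℝ),
        (1 / 2) * ((Real.exp (-|x - u|) - Real.exp (-|x + u|)) * Φ u) * Real.sin (x * y) :=
        integral_integral_swap
          (integrable_mul_sin (integrable_exp_kernel hΦ) (p := fun p => p.1 * y) (by fun_prop))
    _ = ∫ u in Ioi (0 : ℝ), Φ u * Real.sin (u * y) * (1 / (1 + y ^ 2)) := by
        congr 1 with u
        have h := integral_Ioi_translates_mul_sin hk (by simp) u y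
        rw [integral_exp_neg_mul_cos] at h
        calc _ = ∫ x in Ioi (0 : ℝ), (1 / 2) * Φ u *
              ((Real.exp (-|x - u|) - Real.exp (-|x + u|)) * Real.sin (x * y)) := by
              congr 1 with x
              ring
          _ = _ := by
              rw [integral_const_mul, h]
              ring
    _ = _ := by rw [integral_mul_const, mul_one_div]

theorem integrable_phiKer {ψ ξ : ℝ → ℝ} (hψ : IntegrableOn ψ (Ioi 0)) (hξm : Measurable ξ)
    (hξ : IntegrableOn (fun v => |ξ v| * K0 v) (Ioi 0)) :
    Integrable (fun p : ℝ × ℝ × ℝ => phiKer p.1 p.2.2 p.2.1 * ψ p.2.2 * ξ p.2.1)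
      ((volume.restrict (Ioi (0 : ℝ))).prod
        ((volume.restrict (Ioi (0 : ℝ))).prod (volume.restrict (Ioi (0 : ℝ))))) := by
  have hpos : ∀ᵐ a : ℝ × ℝ ∂(volume.restrict (Ioi (0 : ℝ))).prod (volume.restrict (Ioi (0 : ℝ))),
      0 < a.1 :=
    Measure.quasiMeasurePreserving_fst.ae (ae_restrict_mem measurableSet_Ioi)
  have aux (s : ℝ × ℝ → ℝ) (hs : Measurable s) :=
    integrable_translate_mul
      (ν := (volume.restrict (Ioi (0 : ℝ))).prod (volume.restrict (Ioi (0 : ℝ))))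
      (h := fun a x => Real.exp (-a.1 * Real.cosh x)) (w := fun a => ψ a.2 * ξ a.1)
      (by fun_prop) hs
      (hψ.aestronglyMeasurable.comp_snd.mul (hξm.comp measurable_fst).aestronglyMeasurable)
      (hpos.mono fun a ha => integrable_exp_neg_mul_cosh ha)
      (((hξ.mul_prod hψ.abs).const_mul 2).congr (.of_forall fun a => by
        simp only [Real.abs_exp, integral_exp_neg_mul_cosh, abs_mul]
        ring))
  refine ((((aux (fun a => a.2 - 1) (by fun_prop)).add (aux (fun a => -a.2 + 1)
    (by fun_prop))).sub (aux (fun a => a.2 + 1) (by fun_prop))).sub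
    (aux (fun a => -a.2 - 1) (by fun_prop))).congr (.of_forall fun p => ?_)
  simp only [Pi.sub_apply, Pi.add_apply, phiKer]
  ring_nf

theorem integral_phiKer_mul_cos {v : ℝ} (hv : 0 < v) (u y : ℝ) :
    ∫ x in Ioi (0 : ℝ), phiKer x u v * Real.cos (x * y) =
      4 * Real.sin y * (Kiy y v * Real.sin (u * y)) := by
  have hk := integrable_exp_neg_mul_cosh hv
  have hKiy : ∫ x in Ioi (0 : ℝ), Real.exp (-v * Real.cosh x) * Real.cos (x * y) = Kiy y v := by
    simp only [Kiy, mul_comm y]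
  have h (a : ℝ) := integral_Ioi_translates_mul_cos hk (by simp) a y
  have hint (a : ℝ) : IntegrableOn (fun x => (Real.exp (-v * Real.cosh (x + a)) +
      Real.exp (-v * Real.cosh (x - a))) * Real.cos (x * y)) (Ioi 0) :=
    (integrable_mul_cos ((hk.comp_add_right a).add (hk.comp_sub_right a))
      (by fun_prop)).integrableOn
  simp only [hKiy] at h
  calc _ = ∫ x in Ioi (0 : ℝ), ((Real.exp (-v * Real.cosh (x + (u - 1))) +
          Real.exp (-v * Real.cosh (x - (u - 1)))) * Real.cos (x * y) -
        (Real.exp (-v * Real.cosh (x + (u + 1))) +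
          Real.exp (-v * Real.cosh (x - (u + 1)))) * Real.cos (x * y)) := by
        congr 1 with x
        rw [phiKer, show x + u - 1 = x + (u - 1) by ring, show x - u + 1 = x - (u - 1) by ring,
          show x + u + 1 = x + (u + 1) by ring, show x - u - 1 = x - (u + 1) by ring]
        ring
    _ = _ := by
        rw [integral_sub (hint _) (hint _), h, h, sub_mul, add_mul, one_mul, Real.cos_sub,
          Real.cos_add]
        ring

theorem Fc_gconv {ψ ξ : ℝ → ℝ} (hψ : IntegrableOn ψ (Ioi 0)) (hξm : Measurable ξ)
    (hξ : IntegrableOn (fun v => |ξ v| * K0 v) (Ioi 0)) (y : ℝ) :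
    Fc (gconv ψ ξ) y = Real.sin y * Fs ψ y * KL ξ y := by
  have hF := integrable_phiKer hψ hξm hξ
  have hpos : ∀ᵐ a : ℝ × ℝ ∂(volume.restrict (Ioi (0 : ℝ))).prod (volume.restrict (Ioi (0 : ℝ))),
      0 < a.1 :=
    Measure.quasiMeasurePreserving_fst.ae (ae_restrict_mem measurableSet_Ioi)
  have key : ∫ x in Ioi (0 : ℝ), gconv ψ ξ x * Real.cos (x * y) =
      Real.sin y * ((∫ v in Ioi (0 : ℝ), Kiy y v * ξ v) *
        ∫ u in Ioi (0 : ℝ), ψ u * Real.sin (u * y)) := by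
    calc _ = ∫ x in Ioi (0 : ℝ), ∫ a, (phiKer x a.2 a.1 * ψ a.2 * ξ a.1) * Real.cos (x * y)
          * (1 / 4) ∂(volume.restrict (Ioi (0 : ℝ))).prod (volume.restrict (Ioi (0 : ℝ))) := by
          refine integral_congr_ae ?_
          filter_upwards [hF.prod_right_ae] with x hx
          rw [integral_mul_const, integral_mul_const, integral_prod _ hx, gconv]
          ring
      _ = ∫ a, ∫ x in Ioi (0 : ℝ), (phiKer x a.2 a.1 * ψ a.2 * ξ a.1) * Real.cos (x * y)
          * (1 / 4) ∂volume ∂(volume.restrict (Ioi (0 : ℝ))).prod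
            (volume.restrict (Ioi (0 : ℝ))) :=
          integral_integral_swap
            ((integrable_mul_cos hF (p := fun p => p.1 * y) (by fun_prop)).mul_const _)
      _ = ∫ a, Real.sin y * ((Kiy y a.1 * ξ a.1) * (ψ a.2 * Real.sin (a.2 * y)))
          ∂(volume.restrict (Ioi (0 : ℝ))).prod (volume.restrict (Ioi (0 : ℝ))) := by
          refine integral_congr_ae ?_
          filter_upwards [hpos] with a ha
          calc _ = ∫ x in Ioi (0 : ℝ), (ψ a.2 * ξ a.1 * (1 / 4)) *
                (phiKer x a.2 a.1 * Real.cos (x * y)) := by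
                congr 1 with x
                ring
            _ = _ := by
                rw [integral_const_mul, integral_phiKer_mul_cos ha]
                ring
      _ = _ := by
          rw [integral_const_mul, integral_prod_mul (fun v => Kiy y v * ξ v)
            (fun u => ψ u * Real.sin (u * y))]
  rw [Fc, key, Fs, KL]
  ring

theorem first_kind_factorization (β : ℝ) (hβ : β ∈ Set.Ioo (0 : ℝ) 1) (Φ ξ : ℝ → ℝ)
    (hΦ : MeasureTheory.IntegrableOn Φ (Set.Ioi 0))
    (hξm : Measurable ξ)
    (hξ : MeasureTheory.IntegrableOn (fun v => |ξ v| * K0 (β * v)) (Set.Ioi 0)) :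
    ∀ y ∈ Set.Ioi (0 : ℝ),
      (1 + y ^ 2) *
        Fc (gconv (fscConv Φ (fun t => Real.sqrt (Real.pi / 2) * Real.exp (-t))) ξ) y =
      Real.sin y * Fs Φ y * KL ξ y := by
  intro y _
  rw [Fc_gconv (integrableOn_fscConv_exp hΦ) hξm (integrableOn_mul_K0 hβ hξm hξ),
    Fs_fscConv_exp hΦ]
  have : 1 + y ^ 2 ≠ 0 := by positivity
  field_simp
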